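/- Let n ≥ 2 be an integer, set m = (n−3)/2, let κ > 0 be real, let γ be real with |γ| < κ/(2(m+1)), and let c > 1 be real. Then there exists z₀ ∈ (0, m+1) such that for every z ∈ (z₀, m+1) there exists ρ₀ with ρ₋(z) ≤ ρ₀ ≤ ρ₊(z) satisfying the transcendental equation 2·(a₀/b₀)·M(a₀+1, b₀+1; ρ₀) = (1 − 2γz/κ)·M(a₀, b₀; ρ₀), where a₀ = m + 1 − z, b₀ = 2m + 2, ρ₋(z) = log(1 − 2γz/κ) + log((m+1)/(m+1−z)), and ρ₊(z) = c·log((m+1)/(m+1−z)). -/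

import Mathlib

/-- The rising factorial (Pochhammer symbol) `(a)_k = a (a+1) ⋯ (a+k-1)`, with `(a)_0 = 1`. -/
noncomputable def risingFactorial (a : ℝ) (k : ℕ) : ℝ :=
  ∏ i ∈ Finset.range k, (a + i)

/-- The confluent hypergeometric function of the first kind,
`M(a,b;ρ) = ∑_{k=0}^∞ ((a)_k/(b)_k) ρ^k/k!`. -/
noncomputable def CHF_M (a b ρ : ℝ) : ℝ :=
  ∑' k : ℕ, risingFactorial a k / risingFactorial b k * ρ ^ k / (Nat.factorial k : ℝ)

open Filter Topology Set

theorem risingFactorial_pos {a : ℝ} (ha : 0 < a) (k : ℕ) : 0 < risingFactorial a k :=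
  Finset.prod_pos fun i _ => by positivity

theorem risingFactorial_mono {a b : ℝ} (ha : 0 < a) (hab : a ≤ b) (k : ℕ) :
    risingFactorial a k ≤ risingFactorial b k :=
  Finset.prod_le_prod (fun i _ => by positivity) fun i _ => by linarith

theorem risingFactorial_succ (a : ℝ) (k : ℕ) :
    risingFactorial a (k + 1) = risingFactorial a k * (a + k) :=
  Finset.prod_range_succ _ _

theorem risingFactorial_succ_left (a : ℝ) (k : ℕ) :
    risingFactorial a (k + 1) = a * risingFactorial (a + 1) k := by
  unfold risingFactorial
  rw [Finset.prod_range_succ', mul_comm]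
  push_cast
  simp only [add_zero]
  congr 1
  exact Finset.prod_congr rfl fun i _ => by ring

theorem risingFactorial_div_pos {a b : ℝ} (ha : 0 < a) (hb : 0 < b) (k : ℕ) :
    0 < risingFactorial a k / risingFactorial b k :=
  div_pos (risingFactorial_pos ha k) (risingFactorial_pos hb k)

theorem risingFactorial_div_le_one {a b : ℝ} (ha : 0 < a) (hab : a ≤ b) (k : ℕ) :
    risingFactorial a k / risingFactorial b k ≤ 1 :=
  div_le_one_of_le₀ (risingFactorial_mono ha hab k) (risingFactorial_pos (ha.trans_le hab) k).le

/-- The `k`-th term of the power series defining `CHF_M a b ρ`. -/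
noncomputable def chfTerm (a b ρ : ℝ) (k : ℕ) : ℝ :=
  risingFactorial a k / risingFactorial b k * ρ ^ k / (Nat.factorial k : ℝ)

theorem chfTerm_zero (a b ρ : ℝ) : chfTerm a b ρ 0 = 1 := by
  simp [chfTerm, risingFactorial]

theorem chfTerm_nonneg {a b ρ : ℝ} (ha : 0 < a) (hb : 0 < b) (hρ : 0 ≤ ρ) (k : ℕ) :
    0 ≤ chfTerm a b ρ k := by
  have := risingFactorial_div_pos ha hb k
  unfold chfTerm
  positivity

theorem chfTerm_le {a b ρ : ℝ} (ha : 0 < a) (hab : a ≤ b) (hρ : 0 ≤ ρ) (k : ℕ) :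
    chfTerm a b ρ k ≤ ρ ^ k / (Nat.factorial k : ℝ) := by
  unfold chfTerm
  gcongr
  exact mul_le_of_le_one_left (by positivity) (risingFactorial_div_le_one ha hab k)

theorem chfTerm_shift (a b ρ : ℝ) (k : ℕ) :
    a / b * chfTerm (a + 1) (b + 1) ρ k = chfTerm a b ρ k * ((a + k) / (b + k)) := by
  have h : a / b * (risingFactorial (a + 1) k / risingFactorial (b + 1) k)
      = risingFactorial a k / risingFactorial b k * ((a + k) / (b + k)) := by
    rw [div_mul_div_comm, div_mul_div_comm, ← risingFactorial_succ, ← risingFactorial_succ,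
      risingFactorial_succ_left, risingFactorial_succ_left]
  unfold chfTerm
  linear_combination (ρ ^ k / (Nat.factorial k : ℝ)) * h

theorem summable_chfTerm {a b ρ : ℝ} (ha : 0 < a) (hab : a ≤ b) (hρ : 0 ≤ ρ) :
    Summable (chfTerm a b ρ) :=
  (Real.summable_pow_div_factorial ρ).of_nonneg_of_le
    (chfTerm_nonneg ha (ha.trans_le hab) hρ) (chfTerm_le ha hab hρ)

theorem hasSum_CHF_M {a b ρ : ℝ} (ha : 0 < a) (hab : a ≤ b) (hρ : 0 ≤ ρ) :
    HasSum (chfTerm a b ρ) (CHF_M a b ρ) :=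
  (summable_chfTerm ha hab hρ).hasSum

theorem hasSum_pow_div_factorial (x : ℝ) :
    HasSum (fun k : ℕ => x ^ k / (Nat.factorial k : ℝ)) (Real.exp x) := by
  rw [Real.exp_eq_exp_ℝ]
  exact NormedSpace.expSeries_div_hasSum_exp x

theorem CHF_M_le_exp {a b ρ : ℝ} (ha : 0 < a) (hab : a ≤ b) (hρ : 0 ≤ ρ) :
    CHF_M a b ρ ≤ Real.exp ρ :=
  hasSum_le (chfTerm_le ha hab hρ) (hasSum_CHF_M ha hab hρ) (hasSum_pow_div_factorial ρ)

theorem one_le_CHF_M {a b ρ : ℝ} (ha : 0 < a) (hab : a ≤ b) (hρ : 0 ≤ ρ) :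
    1 ≤ CHF_M a b ρ := by
  rw [← chfTerm_zero a b ρ]
  exact le_hasSum (hasSum_CHF_M ha hab hρ) 0
    fun k _ => chfTerm_nonneg ha (ha.trans_le hab) hρ k

theorem continuousOn_CHF_M {a b : ℝ} (ha : 0 < a) (hab : a ≤ b) (R : ℝ) :
    ContinuousOn (CHF_M a b) (Icc 0 R) := by
  refine continuousOn_tsum (u := fun k : ℕ => R ^ k / (Nat.factorial k : ℝ))
    (fun k => by fun_prop) (Real.summable_pow_div_factorial R) fun k ρ hρ => ?_
  change ‖chfTerm a b ρ k‖ ≤ _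
  rw [Real.norm_of_nonneg (chfTerm_nonneg ha (ha.trans_le hab) hρ.1 k)]
  refine (chfTerm_le ha hab hρ.1 k).trans ?_
  have := hρ.1
  have := hρ.2
  gcongr

/-- Beyond the first `K` terms, the series of `M(a,b;ρ)` is dominated by that of its derivative. -/
theorem CHF_M_le_deriv_add {a b ρ ε : ℝ} (ha : 0 < a) (hab : a ≤ b) (hρ : 0 ≤ ρ) (hε : 0 < ε)
    {K : ℕ} (hK : ∀ k : ℕ, K ≤ k → b + k ≤ (1 + ε) * k) :
    CHF_M a b ρ ≤ (1 + ε) * (a / b * CHF_M (a + 1) (b + 1) ρ)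
      + (1 + a / b * ∑ k ∈ Finset.range K, ρ ^ k) := by
  have hb : 0 < b := ha.trans_le hab
  have hderiv := ((hasSum_CHF_M (ρ := ρ) (a := a + 1) (b := b + 1) (by linarith) (by linarith)
    hρ).mul_left (a / b)).mul_left (1 + ε)
  have hhead : HasSum (fun k : ℕ => if k < K then a / b * ρ ^ k else 0)
      (a / b * ∑ k ∈ Finset.range K, ρ ^ k) := by
    have h := hasSum_sum_of_ne_finset_zero (L := SummationFilter.unconditional ℕ)
      (f := fun k : ℕ => if k < K then a / b * ρ ^ k else 0) (s := Finset.range K)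
      (fun k hk => if_neg (by simpa using hk))
    rw [Finset.mul_sum]
    rwa [Finset.sum_congr rfl fun k hk => if_pos (Finset.mem_range.1 hk)] at h
  refine hasSum_le (fun k => ?_) (hasSum_CHF_M ha hab hρ)
    (hderiv.add ((hasSum_ite_eq 0 (1 : ℝ)).add hhead))
  have ht := chfTerm_nonneg ha hb hρ k
  have hbk : 0 < b + k := by positivity
  have hshift := chfTerm_shift a b ρ k
  have hnn : 0 ≤ (1 + ε) * (a / b * chfTerm (a + 1) (b + 1) ρ k) := by
    rw [hshift]; positivity
  rcases lt_or_ge k K with hk | hk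
  · rw [if_pos hk]
    rcases k with _ | k
    · have : 0 ≤ a / b * ρ ^ 0 := by positivity
      rw [if_pos rfl, chfTerm_zero a b]
      linarith
    · rw [if_neg (Nat.succ_ne_zero k)]
      have hle : chfTerm a b ρ (k + 1) ≤ a / b * ρ ^ (k + 1) := by
        have h1 : risingFactorial a (k + 1) / risingFactorial b (k + 1) ≤ a / b := by
          rw [risingFactorial_succ_left, risingFactorial_succ_left, ← div_mul_div_comm]
          exact mul_le_of_le_one_right (by positivity)
            (risingFactorial_div_le_one (by linarith) (by linarith) k)
        have h2 : (1 : ℝ) ≤ (Nat.factorial (k + 1) : ℝ) := by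
          exact_mod_cast Nat.one_le_iff_ne_zero.2 (Nat.factorial_ne_zero _)
        unfold chfTerm
        refine (div_le_self ?_ h2).trans ?_
        · have := risingFactorial_div_pos ha hb (k + 1)
          positivity
        · gcongr
      linarith
  · rw [if_neg (by omega : ¬ k < K)]
    have h1 : 1 ≤ (1 + ε) * ((a + k) / (b + k)) := by
      rw [← mul_div_assoc, le_div_iff₀ hbk]
      nlinarith [hK k hk]
    have h2 : chfTerm a b ρ k ≤ (1 + ε) * (a / b * chfTerm (a + 1) (b + 1) ρ k) := by
      rw [hshift]
      nlinarith
    have h3 : (0 : ℝ) ≤ if k = 0 then 1 else 0 := by split_ifs <;> norm_num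
    linarith

/-- For `θ < 1` the quotients `(1)_k / (b)_k` decay more slowly than `θ ^ k`. -/
theorem exists_geometric_le_risingFactorial_div {b θ : ℝ} (hb : 1 ≤ b) (hθ0 : 0 < θ)
    (hθ1 : θ < 1) :
    ∃ C : ℝ, 0 < C ∧ ∀ k : ℕ, C * θ ^ k ≤ risingFactorial 1 k / risingFactorial b k := by
  have hb0 : 0 < b := by linarith
  obtain ⟨K, hK⟩ := exists_nat_ge (θ * b / (1 - θ))
  rw [div_le_iff₀ (by linarith)] at hK
  set u : ℕ → ℝ := fun k => risingFactorial 1 k / risingFactorial b k with hu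
  have hpos : ∀ k, 0 < u k := risingFactorial_div_pos one_pos hb0
  have hstep : ∀ k, u (k + 1) = u k * ((1 + k) / (b + k)) := fun k => by
    simp only [hu, risingFactorial_succ, div_mul_div_comm]
  have hanti : Antitone u := antitone_nat_of_succ_le fun k => by
    rw [hstep]
    exact mul_le_of_le_one_right (hpos k).le
      (div_le_one_of_le₀ (by linarith) (by positivity))
  refine ⟨u K, hpos K, fun k => ?_⟩
  change u K * θ ^ k ≤ u k
  rcases le_total k K with hk | hk
  · exact (mul_le_of_le_one_right (hpos K).le (pow_le_one₀ hθ0.le hθ1.le)).trans (hanti hk)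
  · induction k, hk using Nat.le_induction with
    | base => exact mul_le_of_le_one_right (hpos K).le (pow_le_one₀ hθ0.le hθ1.le)
    | succ k hk ih =>
      have hkK : (K : ℝ) ≤ k := by exact_mod_cast hk
      have hθ : θ ≤ (1 + k) / (b + k) := by
        rw [le_div_iff₀ (by positivity)]
        nlinarith
      rw [hstep, pow_succ, ← mul_assoc]
      exact mul_le_mul ih hθ hθ0.le (hpos k).le

/-- An exponential lower bound for `M(a,b;ρ)`, uniform in `a ≥ 1`. -/
theorem exists_exp_le_CHF_M {b θ : ℝ} (hb : 1 ≤ b) (hθ0 : 0 < θ) (hθ1 : θ < 1) :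
    ∃ C : ℝ, 0 < C ∧ ∀ a ρ : ℝ, 1 ≤ a → a ≤ b → 0 ≤ ρ →
      C * Real.exp (θ * ρ) ≤ CHF_M a b ρ := by
  obtain ⟨C, hC, hle⟩ := exists_geometric_le_risingFactorial_div hb hθ0 hθ1
  refine ⟨C, hC, fun a ρ ha hab hρ => ?_⟩
  refine hasSum_le (fun k => ?_) ((hasSum_pow_div_factorial (θ * ρ)).mul_left C)
    (hasSum_CHF_M (by linarith) hab hρ)
  have h : C * θ ^ k ≤ risingFactorial a k / risingFactorial b k :=
    (hle k).trans (div_le_div_of_nonneg_right (risingFactorial_mono one_pos ha k)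
      (risingFactorial_pos (by linarith) k).le)
  calc C * ((θ * ρ) ^ k / (Nat.factorial k : ℝ))
      = C * θ ^ k * ρ ^ k / (Nat.factorial k : ℝ) := by rw [mul_pow]; ring
    _ ≤ chfTerm a b ρ k := by unfold chfTerm; gcongr

/-- At the upper endpoint the derivative side of the equation dominates, uniformly in `δ`. -/
theorem eventually_mul_CHF_M_le {s c d : ℝ} (hs : 0 < s) (hc : 1 < c) (hd : 0 < d) :
    ∀ᶠ L in atTop, ∀ δ, 0 ≤ δ → δ ≤ 2 - d →
      δ * CHF_M (s * Real.exp (-L)) (2 * s) (c * L)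
        ≤ 2 * (s * Real.exp (-L) / (2 * s))
          * CHF_M (s * Real.exp (-L) + 1) (2 * s + 1) (c * L) := by
  obtain ⟨K, hK⟩ := exists_nat_ge (2 * s / (d / 4))
  rw [div_le_iff₀ (by linarith)] at hK
  obtain ⟨θ, hθl, hθ1⟩ := exists_between (inv_lt_one_of_one_lt₀ hc)
  have hθ0 : 0 < θ := (inv_pos.2 (by linarith)).trans hθl
  have hθc : 1 < θ * c := by rwa [inv_lt_iff_one_lt_mul₀ (by linarith)] at hθl
  obtain ⟨C, hC, hlow⟩ := exists_exp_le_CHF_M (b := 2 * s + 1) (by linarith) hθ0 hθ1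
  have hsum : Tendsto (fun L : ℝ =>
      ∑ k ∈ Finset.range K, c ^ k / 2 * (L ^ k * Real.exp (-L))) atTop (𝓝 0) := by
    have h := tendsto_finsetSum (Finset.range K) fun k _ =>
      (Real.tendsto_pow_mul_exp_neg_atTop_nhds_zero k).const_mul (c ^ k / 2)
    simpa using h
  have hexp : Tendsto (fun L : ℝ => C / 2 * Real.exp ((θ * c - 1) * L)) atTop atTop :=
    (Real.tendsto_exp_atTop.comp
      (tendsto_id.const_mul_atTop (by linarith : 0 < θ * c - 1))).const_mul_atTop (by positivity)
  filter_upwards [hsum.eventually_le_const one_pos, hexp.eventually_ge_atTop (8 / d),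
    eventually_ge_atTop 0] with L h1 h2 hL δ hδ0 hδ
  have he : Real.exp (-L) ≤ 1 := Real.exp_le_one_iff.2 (by linarith)
  have he0 := Real.exp_pos (-L)
  set a := s * Real.exp (-L) with ha
  have ha0 : 0 < a := by positivity
  have has : a ≤ s := mul_le_of_le_one_right hs.le he
  have hρ : 0 ≤ c * L := by positivity
  have hq : a / (2 * s) = Real.exp (-L) / 2 := by rw [ha]; field_simp
  have hup := CHF_M_le_deriv_add (a := a) (b := 2 * s) (ε := d / 4) (K := K) ha0 (by linarith) hρ
    (by linarith) fun k hk => by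
      have : (K : ℝ) ≤ k := by exact_mod_cast hk
      nlinarith
  have hrem : a / (2 * s) * ∑ k ∈ Finset.range K, (c * L) ^ k ≤ 1 := by
    rw [hq, Finset.mul_sum]
    refine le_trans (le_of_eq (Finset.sum_congr rfl fun k _ => ?_)) h1
    rw [mul_pow]; ring
  have hbig : 8 / d ≤ a / (2 * s) * CHF_M (a + 1) (2 * s + 1) (c * L) := by
    refine h2.trans ?_
    have h := hlow (a + 1) (c * L) (by linarith) (by linarith) hρ
    have hsplit : Real.exp ((θ * c - 1) * L) = Real.exp (-L) * Real.exp (θ * (c * L)) := by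
      rw [← Real.exp_add]; ring_nf
    rw [hq, hsplit]
    nlinarith
  rw [mul_assoc]
  set D := a / (2 * s) * CHF_M (a + 1) (2 * s + 1) (c * L)
  rw [div_le_iff₀ hd] at hbig
  have hD : 0 ≤ D := by nlinarith
  calc δ * CHF_M a (2 * s) (c * L) ≤ δ * ((1 + d / 4) * D + 2) := by
        gcongr; linarith
    _ ≤ (2 - d) * ((1 + d / 4) * D + 2) := by gcongr
    _ ≤ 2 * D := by nlinarith [mul_nonneg (mul_nonneg hd.le hd.le) hD]

theorem CHF_M_le_mul_of_exp_eq {s a δ ρ : ℝ} (ha : 0 < a) (has : a ≤ s) (hδ : 0 ≤ δ)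
    (hρ : 0 ≤ ρ) (hexp : a / s * Real.exp ρ = δ) :
    2 * (a / (2 * s)) * CHF_M (a + 1) (2 * s + 1) ρ ≤ δ * CHF_M a (2 * s) ρ := by
  have hs : 0 < s := ha.trans_le has
  have h2 : 2 * (a / (2 * s)) = a / s := by field_simp
  calc 2 * (a / (2 * s)) * CHF_M (a + 1) (2 * s + 1) ρ
      ≤ a / s * Real.exp ρ := by
        rw [h2]
        gcongr
        exact CHF_M_le_exp (by linarith) (by linarith) hρ
    _ = δ * 1 := by rw [hexp, mul_one]
    _ ≤ δ * CHF_M a (2 * s) ρ := by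
        gcongr
        exact one_le_CHF_M ha (by linarith) hρ

theorem eventually_exists_root {s c d : ℝ} (hs : 0 < s) (hc : 1 < c) (hd : 0 < d) :
    ∀ᶠ L in atTop, ∀ δ, d ≤ δ → δ ≤ 2 - d →
      ∃ ρ, Real.log δ + L ≤ ρ ∧ ρ ≤ c * L ∧
        2 * (s * Real.exp (-L) / (2 * s)) * CHF_M (s * Real.exp (-L) + 1) (2 * s + 1) ρ
          = δ * CHF_M (s * Real.exp (-L)) (2 * s) ρ := by
  filter_upwards [eventually_mul_CHF_M_le hs hc hd, eventually_ge_atTop 0,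
    eventually_ge_atTop (-Real.log d), eventually_ge_atTop (Real.log 2 / (c - 1))]
    with L hupper hL hLd hL2 δ hδ hδ2
  have hδ0 : 0 < δ := hd.trans_le hδ
  rw [div_le_iff₀ (by linarith)] at hL2
  have hlogd : Real.log d ≤ Real.log δ := Real.log_le_log hd hδ
  have hlog2 : Real.log δ ≤ Real.log 2 := Real.log_le_log hδ0 (by linarith)
  have he : Real.exp (-L) ≤ 1 := Real.exp_le_one_iff.2 (by linarith)
  have hlower := CHF_M_le_mul_of_exp_eq (s := s) (a := s * Real.exp (-L)) (δ := δ)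
    (ρ := Real.log δ + L) (by positivity) (mul_le_of_le_one_right hs.le he) hδ0.le (by linarith)
    (by
      rw [mul_div_cancel_left₀ _ hs.ne', Real.exp_add, Real.exp_log hδ0, Real.exp_neg]
      field_simp)
  specialize hupper δ hδ0.le hδ2
  set a := s * Real.exp (-L) with ha
  have ha0 : 0 < a := by positivity
  have has : a ≤ s := mul_le_of_le_one_right hs.le he
  have hsub : Icc (Real.log δ + L) (c * L) ⊆ Icc 0 (c * L) :=
    Icc_subset_Icc_left (by linarith)
  have hc1 := (continuousOn_CHF_M (a := a + 1) (b := 2 * s + 1) (by linarith) (by linarith)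
    (c * L)).mono hsub
  have hc2 := (continuousOn_CHF_M (a := a) (b := 2 * s) ha0 (by linarith) (c * L)).mono hsub
  obtain ⟨ρ, hρ, h0⟩ := intermediate_value_Icc (by linarith)
    ((hc1.const_mul (2 * (a / (2 * s)))).sub (hc2.const_mul δ))
    (show (0 : ℝ) ∈ Icc _ _ from ⟨sub_nonpos.2 hlower, sub_nonneg.2 hupper⟩)
  exact ⟨ρ, hρ.1, hρ.2, sub_eq_zero.1 h0⟩

/-- Let `n ≥ 2`, `m = (n−3)/2`, `κ > 0`, `|γ| < κ/(2(m+1))`, `c > 1`.  Then there exists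
`z₀ ∈ (0, m+1)` such that for every `z ∈ (z₀, m+1)` there is `ρ₀` with
`ρ₋(z) ≤ ρ₀ ≤ ρ₊(z)` solving `2 (a₀/b₀) M(a₀+1,b₀+1;ρ₀) = (1 − 2γz/κ) M(a₀,b₀;ρ₀)`,
where `a₀ = m+1−z`, `b₀ = 2m+2`, `ρ₋(z) = log(1 − 2γz/κ) + log((m+1)/(m+1−z))` and
`ρ₊(z) = c log((m+1)/(m+1−z))`. -/
theorem transcendental_root_exists (n : ℕ) (hn : 2 ≤ n) (m : ℝ) (hm : m = ((n : ℝ) - 3) / 2)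
    (κ γ : ℝ) (hκ : 0 < κ) (hγ : |γ| < κ / (2 * (m + 1))) (c : ℝ) (hc : 1 < c) :
    ∃ z₀ ∈ Set.Ioo (0 : ℝ) (m + 1), ∀ z ∈ Set.Ioo z₀ (m + 1),
      ∃ ρ₀ : ℝ,
        Real.log (1 - 2 * γ * z / κ) + Real.log ((m + 1) / (m + 1 - z)) ≤ ρ₀ ∧
        ρ₀ ≤ c * Real.log ((m + 1) / (m + 1 - z)) ∧
        2 * ((m + 1 - z) / (2 * m + 2)) * CHF_M (m + 1 - z + 1) (2 * m + 2 + 1) ρ₀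
          = (1 - 2 * γ * z / κ) * CHF_M (m + 1 - z) (2 * m + 2) ρ₀ := by
  have hn' : (2 : ℝ) ≤ n := by exact_mod_cast hn
  have hs : 0 < m + 1 := by rw [hm]; linarith
  obtain ⟨s, hsm⟩ : ∃ s, s = m + 1 := ⟨_, rfl⟩
  have h2s : 2 * m + 2 = 2 * s := by rw [hsm]; ring
  rw [← hsm] at hs hγ ⊢
  rw [h2s]
  rw [lt_div_iff₀ (by positivity)] at hγ
  have hd : 0 < 1 - 2 * |γ| * s / κ := by
    rw [sub_pos, div_lt_one hκ]
    linarith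
  obtain ⟨L₀, hL₀⟩ := eventually_atTop.1 (eventually_exists_root hs hc hd)
  have hpos : (0 : ℝ) < max L₀ 1 := lt_max_of_lt_right one_pos
  have hexp1 : Real.exp (-max L₀ 1) < 1 := Real.exp_lt_one_iff.2 (by linarith)
  have hexp0 := Real.exp_pos (-max L₀ 1)
  refine ⟨s - s * Real.exp (-max L₀ 1), ⟨by nlinarith, by nlinarith⟩, fun z hz => ?_⟩
  have hz0 : 0 < z := lt_trans (by nlinarith) hz.1
  have hsz : 0 < s - z := sub_pos.2 hz.2
  have hexpL : s * Real.exp (-Real.log (s / (s - z))) = s - z := by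
    rw [Real.exp_neg, Real.exp_log (by positivity)]
    field_simp
  have hL : L₀ ≤ Real.log (s / (s - z)) := by
    refine (le_max_left L₀ 1).trans ?_
    rw [← neg_le_neg_iff, ← Real.exp_le_exp, ← mul_le_mul_iff_right₀ hs, hexpL]
    linarith [hz.1]
  have habs : |2 * γ * z / κ| ≤ 2 * |γ| * s / κ := by
    rw [abs_div, abs_mul, abs_mul, abs_of_pos hκ, abs_of_pos hz0, abs_two]
    gcongr
    exact hz.2.le
  obtain ⟨hl, hr⟩ := abs_le.1 habs
  have key := hL₀ _ hL (1 - 2 * γ * z / κ) (by linarith) (by linarith)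
  rwa [hexpL] at key
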